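/- Let K ≥ 1 and z : Fin K → {0,1}, and suppose S := #{i : z(i) = 1} is odd. Then M_z.mulVec G_K = (-1)^{(S+1)/2} · i • G_K⁻, where G_K⁻ : (Fin K → Fin 2) → ℂ equals 1/√2 on the constant-0 function, −1/√2 on the constant-1 function, and 0 otherwise. -/

import Mathlib

open Matrix

/-- Pauli matrices: `pauli 0 = σ₁` (Pauli-X) and `pauli 1 = σ₂` (Pauli-Y). -/
noncomputable def pauli : Fin 2 → Matrix (Fin 2) (Fin 2) ℂ
  | 0 => !![0, 1; 1, 0]
  | 1 => !![0, -Complex.I; Complex.I, 0]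

/-- `Mz K z` is the tensor (Kronecker) product over the `K` sites of `σ₁` at
sites with `z i = 0` and `σ₂` at sites with `z i = 1`:
`(Mz K z) f g = ∏ i, σ_{1 + z i} (f i) (g i)`. -/
noncomputable def Mz (K : ℕ) (z : Fin K → Fin 2) :
    Matrix (Fin K → Fin 2) (Fin K → Fin 2) ℂ :=
  Matrix.of fun f g => ∏ i, pauli (z i) (f i) (g i)

/-- The `K`-qubit GHZ state `(|0…0⟩ + |1…1⟩)/√2` as a vector on
`(Fin K → Fin 2) → ℂ`. -/
noncomputable def GHZ (K : ℕ) : (Fin K → Fin 2) → ℂ :=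
  fun f => if (∀ i, f i = 0) ∨ (∀ i, f i = 1) then ((1 / Real.sqrt 2 : ℝ) : ℂ) else 0

/-- The state `G_K⁻ = (|0…0⟩ - |1…1⟩)/√2`. -/
noncomputable def GHZminus (K : ℕ) : (Fin K → Fin 2) → ℂ :=
  fun f =>
    if ∀ i, f i = 0 then ((1 / Real.sqrt 2 : ℝ) : ℂ)
    else if ∀ i, f i = 1 then -((1 / Real.sqrt 2 : ℝ) : ℂ)
    else 0

theorem pauli_eq_zero {a x y : Fin 2} (h : y ≠ x + 1) : pauli a x y = 0 := by
  fin_cases a <;> fin_cases x <;> fin_cases y <;> simp_all [pauli]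

theorem pauli_zero_one (a : Fin 2) : pauli a 0 1 = if a = 1 then -Complex.I else 1 := by
  fin_cases a <;> simp [pauli]

theorem pauli_one_zero (a : Fin 2) : pauli a 1 0 = if a = 1 then Complex.I else 1 := by
  fin_cases a <;> simp [pauli]

/-- Each row of `Mz K z` has its only nonzero entry in the column of the bit-flipped index. -/
theorem Mz_mulVec_apply (K : ℕ) (z : Fin K → Fin 2) (v : (Fin K → Fin 2) → ℂ)
    (f : Fin K → Fin 2) :
    (Mz K z).mulVec v f = (∏ i, pauli (z i) (f i) (f i + 1)) * v (fun i => f i + 1) := by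
  rw [Matrix.mulVec, dotProduct, Finset.sum_eq_single (fun i => f i + 1)]
  · simp [Mz]
  · intro g _ hg
    obtain ⟨i, hi⟩ := Function.ne_iff.mp hg
    have h : Mz K z f g = 0 := Finset.prod_eq_zero (Finset.mem_univ i) (pauli_eq_zero hi)
    rw [h, zero_mul]
  · simp

theorem GHZ_flip (K : ℕ) (f : Fin K → Fin 2) : GHZ K (fun i => f i + 1) = GHZ K f := by
  have h0 : ∀ x : Fin 2, x + 1 = 0 ↔ x = 1 := by decide
  have h1 : ∀ x : Fin 2, x + 1 = 1 ↔ x = 0 := by decide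
  simp only [GHZ, h0, h1, or_comm]

/-- If the number `S` of sites where `z i = 1` (Pauli-Y sites) is odd, then
`Mz K z` maps the GHZ state to `(-1)^{(S+1)/2} · i · G_K⁻`. -/
theorem ghz_image_odd (K : ℕ) (hK : 1 ≤ K) (z : Fin K → Fin 2)
    (hS : Odd (Finset.univ.filter (fun i => z i = 1)).card) :
    (Mz K z).mulVec (GHZ K) =
      (((-1 : ℂ) ^ (((Finset.univ.filter (fun i => z i = 1)).card + 1) / 2)) *
        Complex.I) • GHZminus K := by
  obtain ⟨m, hm⟩ := hS
  have hhalf : (2 * m + 1 + 1) / 2 = m + 1 := by omega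
  ext f
  rw [Mz_mulVec_apply, GHZ_flip, hm, hhalf, Pi.smul_apply, smul_eq_mul]
  by_cases h0 : ∀ i, f i = 0
  · have hprod : ∏ i, pauli (z i) (f i) (f i + 1) = (-Complex.I) ^ (2 * m + 1) := by
      simp only [h0, zero_add, pauli_zero_one, Finset.prod_ite, Finset.prod_const,
        one_pow, mul_one, hm]
    rw [hprod, pow_succ, pow_mul, neg_sq, Complex.I_sq, GHZ, GHZminus, if_pos (Or.inl h0),
      if_pos h0]
    ring
  by_cases h1 : ∀ i, f i = 1
  · have h11 : (1 + 1 : Fin 2) = 0 := rfl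
    have hprod : ∏ i, pauli (z i) (f i) (f i + 1) = Complex.I ^ (2 * m + 1) := by
      simp only [h1, h11, pauli_one_zero, Finset.prod_ite, Finset.prod_const,
        one_pow, mul_one, hm]
    rw [hprod, pow_succ, pow_mul, Complex.I_sq, GHZ, GHZminus, if_pos (Or.inr h1),
      if_neg h0, if_pos h1]
    ring
  · rw [GHZ, GHZminus, if_neg (not_or.mpr ⟨h0, h1⟩), if_neg h0, if_neg h1, mul_zero, mul_zero]
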